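/- Let γ → δ be a frank right action by a letter c with bumped letter b (so δ = (γ\b) ∪ {c}). Then in ℤStyl(A): e_γ c e_δ = e_γ c. -/

import Mathlib

noncomputable section

open FreeMonoid

/-- The defining relations of the stylic congruence: the Knuth (plactic)
relations together with the idempotent relations `a² ≡ a`. -/
inductive StylicRel (A : Type*) [LinearOrder A] : FreeMonoid A → FreeMonoid A → Prop
  | knuth1 {a b c : A} : a < b → b < c →
      StylicRel A (ofList [b, a, c]) (ofList [b, c, a])
  | knuth2 {a b c : A} : a < b → b < c →
      StylicRel A (ofList [a, c, b]) (ofList [c, a, b])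
  | knuth3 {a b : A} : a < b →
      StylicRel A (ofList [b, a, b]) (ofList [b, b, a])
  | knuth4 {a b : A} : a < b →
      StylicRel A (ofList [a, b, a]) (ofList [b, a, a])
  | idem (a : A) : StylicRel A (ofList [a, a]) (ofList [a])

/-- The stylic congruence on the free monoid `A*`. -/
def stylCon (A : Type*) [LinearOrder A] : Con (FreeMonoid A) := conGen (StylicRel A)

/-- The stylic monoid `Styl(A)`. -/
abbrev Styl (A : Type*) [LinearOrder A] := (stylCon A).Quotient

/-- The image of a letter `a` in the stylic algebra `ℤStyl(A)`. -/
def styGen {A : Type*} [LinearOrder A] (a : A) : MonoidAlgebra ℤ (Styl A) :=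
  MonoidAlgebra.of ℤ (Styl A) ((stylCon A).mk' (FreeMonoid.of a))

/-- The idempotent `e_γ = (∏_{a∉γ}^{↗} (1-a)) · (∏_{a∈γ}^{↘} a)` of `ℤStyl(A)`
associated with a column (subset) `γ ⊆ A`. -/
def eIdem {A : Type*} [LinearOrder A] [Fintype A] (γ : Finset A) :
    MonoidAlgebra ℤ (Styl A) :=
  (((γᶜ).sort (· ≤ ·)).map (fun a => 1 - styGen a)).prod *
    ((γ.sort (· ≤ ·)).reverse.map styGen).prod

/-- Right action of a letter `c` on a column `γ`: if `c < min γ` then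
`γ ∪ {c}`; otherwise replace `max {x ∈ γ : x ≤ c}` (the bumped letter) by `c`. -/
def rIns {A : Type*} [LinearOrder A] (γ : Finset A) (c : A) : Finset A :=
  if h : (γ.filter (· ≤ c)).Nonempty then
    insert c (γ.erase ((γ.filter (· ≤ c)).max' h))
  else insert c γ

/-- Schensted left column insertion of a letter `b` into a column `δ`:
if `b > max δ` then `δ ∪ {b}`; otherwise replace `min {x ∈ δ : x ≥ b}`
(the bumped letter) by `b`. -/
def lIns {A : Type*} [LinearOrder A] (b : A) (δ : Finset A) : Finset A :=
  if h : (δ.filter (b ≤ ·)).Nonempty then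
    insert b (δ.erase ((δ.filter (b ≤ ·)).min' h))
  else insert b δ

/-- The right action of a word on a column, `γ·(uv) = (γ·u)·v`. -/
def rActW {A : Type*} [LinearOrder A] (γ : Finset A) (w : List A) : Finset A :=
  w.foldl rIns γ

/-- The left action of a word on a column, `(uv)·γ = u·(v·γ)`. -/
def lActW {A : Type*} [LinearOrder A] (w : List A) (γ : Finset A) : Finset A :=
  w.foldr lIns γ

section helpers

variable {A : Type*} [LinearOrder A]

/-- product of letters of a word. -/
def GW (l : List A) : MonoidAlgebra ℤ (Styl A) := (l.map styGen).prod

/-- product of `1 - a` over a word. -/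
def PW (l : List A) : MonoidAlgebra ℤ (Styl A) := (l.map (fun a => 1 - styGen a)).prod

theorem GW_eq (l : List A) :
    GW l = MonoidAlgebra.of ℤ (Styl A) ((stylCon A).mk' (FreeMonoid.ofList l)) := by
  induction l with
  | nil => simp [GW, MonoidAlgebra.one_def]
  | cons a l ih =>
    have h : FreeMonoid.ofList (a :: l) = FreeMonoid.of a * FreeMonoid.ofList l := rfl
    rw [h, map_mul, map_mul, ← ih]
    simp [GW, styGen]

theorem GW_rel {u v : List A} (h : StylicRel A (ofList u) (ofList v)) : GW u = GW v := by
  rw [GW_eq, GW_eq]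
  congr 1
  exact (Con.eq _).2 (ConGen.Rel.of _ _ h)

theorem GW_nil : GW ([] : List A) = 1 := rfl
theorem GW_cons (a : A) (l : List A) : GW (a :: l) = styGen a * GW l := by simp [GW]
theorem GW_append (l m : List A) : GW (l ++ m) = GW l * GW m := by simp [GW]
theorem PW_nil : PW ([] : List A) = 1 := rfl
theorem PW_cons (a : A) (l : List A) : PW (a :: l) = (1 - styGen a) * PW l := by simp [PW]
theorem PW_append (l m : List A) : PW (l ++ m) = PW l * PW m := by simp [PW]

theorem kn1 {a b c : A} (h : a < b) (h' : b < c) :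
    styGen b * (styGen a * styGen c) = styGen b * (styGen c * styGen a) := by
  simpa [GW] using GW_rel (StylicRel.knuth1 h h')
theorem kn2 {a b c : A} (h : a < b) (h' : b < c) :
    styGen a * (styGen c * styGen b) = styGen c * (styGen a * styGen b) := by
  simpa [GW] using GW_rel (StylicRel.knuth2 h h')
theorem kn4 {a b : A} (h : a < b) :
    styGen a * (styGen b * styGen a) = styGen b * (styGen a * styGen a) := by
  simpa [GW] using GW_rel (StylicRel.knuth4 h)
theorem kni (a : A) : styGen a * styGen a = styGen a := by
  simpa [GW] using GW_rel (StylicRel.idem a)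

theorem F1 (c : A) (lo : List A) : ∀ b : A, b < c → (b :: lo).Pairwise (· > ·) →
    styGen b * (GW lo * styGen c) = styGen b * (styGen c * GW lo) := by
  induction lo with
  | nil => intro b _ _; simp [GW_nil]
  | cons y lo ih =>
    intro b hb hp
    have hy : y < b := by
      have := List.rel_of_pairwise_cons hp (a' := y) (by simp)
      exact this
    have e := ih y (hy.trans hb) (List.Pairwise.of_cons hp)
    rw [GW_cons, mul_assoc (styGen y), e, ← mul_assoc (styGen y), ← mul_assoc, kn1 hy hb]
    simp only [mul_assoc]

theorem F2 {b c : A} (hbc : b < c) (hi : List A) (hp : hi.Pairwise (· > ·))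
    (hc : ∀ x ∈ hi, c < x) :
    styGen b * (GW hi * styGen c) = GW hi * (styGen b * styGen c) := by
  induction hi with
  | nil => simp [GW_nil]
  | cons h hi ih =>
    have e := ih hp.of_cons (fun x hx => hc x (by simp [hx]))
    have hh := hc h (by simp)
    rw [GW_cons, mul_assoc (styGen h), mul_assoc (styGen h), ← e]
    cases hi with
    | nil => simp [GW_nil, kn2 hbc hh]
    | cons k hi =>
      have hk : k < h := List.rel_of_pairwise_cons hp (a' := k) (by simp)
      have hk' := hc k (by simp)
      have := kn2 (hbc.trans hk') hk
      rw [GW_cons]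
      simp only [← mul_assoc] at this ⊢
      rw [this]

theorem FB (b : A) (hi : List A) (hp : hi.Pairwise (· > ·))
    (hc : ∀ x ∈ hi, b < x) :
    styGen b * (GW hi * styGen b) = GW hi * styGen b := by
  induction hi with
  | nil => simp [GW_nil, kni]
  | cons h hi ih =>
    have e := ih hp.of_cons (fun x hx => hc x (by simp [hx]))
    have hh := hc h (by simp)
    rw [GW_cons, mul_assoc (styGen h)]
    cases hi with
    | nil => simp [GW_nil, kn4 hh, kni]
    | cons k hi =>
      have hk : k < h := List.rel_of_pairwise_cons hp (a' := k) (by simp)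
      have hk' := hc k (by simp)
      have := kn2 hk' hk
      conv_rhs => rw [← e]
      rw [GW_cons]
      simp only [← mul_assoc] at this ⊢
      rw [this]

theorem L1a (y : A) (l : List A) : ∀ z, y < z → (z :: l).Pairwise (· < ·) →
    styGen z * (PW l * styGen y) = styGen z * (styGen y * PW l) := by
  induction l with
  | nil => intro z _ _; simp [PW_nil]
  | cons w l ih =>
    intro z hz hp
    have hw : z < w := List.rel_of_pairwise_cons hp (a' := w) (by simp)
    have e1 := ih z hz (hp.sublist (by simp))
    have e2 := ih w (hz.trans hw) hp.of_cons
    have k := kn1 hz hw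
    rw [PW_cons, mul_assoc (1 - styGen w), sub_mul, one_mul, e2, mul_sub, e1, sub_mul, one_mul,
      mul_sub, mul_sub]
    congr 1
    simp only [← mul_assoc] at k ⊢
    rw [k]

theorem L1b (y : A) (l : List A) (hp : (y :: l).Pairwise (· < ·)) :
    (1 - styGen y) * (PW l * styGen y) = 0 := by
  induction l with
  | nil => simp [PW_nil, sub_mul, kni]
  | cons z l ih =>
    have hz : y < z := List.rel_of_pairwise_cons hp (a' := z) (by simp)
    have e1 := ih (hp.sublist (by simp))
    have e2 := L1a y l z hz hp.of_cons
    have k := kn4 hz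
    rw [kni] at k
    rw [PW_cons, mul_assoc (1 - styGen z), sub_mul (1 : MonoidAlgebra ℤ (Styl A)) (styGen z),
      one_mul, e2, mul_sub, e1, sub_mul, one_mul, zero_sub, neg_eq_zero, sub_eq_zero]
    simp only [← mul_assoc] at k ⊢
    rw [k]

theorem L1 (x : A) (l : List A) (hp : l.Pairwise (· < ·)) (hx : x ∈ l) :
    PW l * styGen x = 0 := by
  obtain ⟨s, t, rfl⟩ := List.append_of_mem hx
  rw [PW_append, PW_cons, mul_assoc, mul_assoc, L1b x t (List.pairwise_append.1 hp).2.1, mul_zero]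

/-- column word -/
def CW (γ : Finset A) : List A := (γ.sort (· ≤ ·)).reverse

theorem CW_pw (γ : Finset A) : (CW γ).Pairwise (· > ·) := by
  rw [CW, List.pairwise_reverse]
  exact (Finset.sortedLT_sort γ).pairwise

theorem mem_CW (γ : Finset A) (x : A) : x ∈ CW γ ↔ x ∈ γ := by simp [CW]

theorem CW_uniq (γ : Finset A) (l : List A) (hl : l.Pairwise (· > ·))
    (h : ∀ x, x ∈ l ↔ x ∈ γ) : CW γ = l := by
  have hn : l.Nodup := hl.imp (fun h => ne_of_gt h)
  have hn' : (CW γ).Nodup := (CW_pw γ).imp (fun h => ne_of_gt h)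
  refine List.Perm.eq_of_pairwise (le := (· > ·)) ?_ (CW_pw γ) hl ?_
  · intro a b _ _ h1 h2
    exact absurd h1 (not_lt_of_gt h2)
  · rw [List.perm_ext_iff_of_nodup hn' hn]
    intro x
    rw [mem_CW, h]

theorem split_pw (γ : Finset A) (z w : A) (h : z ≤ w) (m : A) (hm : z ≤ m) (hm' : m ≤ w) :
    (CW (γ.filter (w < ·)) ++ m :: CW (γ.filter (· < z))).Pairwise (· > ·) := by
  rw [List.pairwise_append, List.pairwise_cons]
  refine ⟨CW_pw _, ⟨?_, CW_pw _⟩, ?_⟩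
  · intro x hx
    rw [mem_CW] at hx
    exact (Finset.mem_filter.1 hx).2.trans_le hm
  · intro x hx y hy
    rw [mem_CW] at hx
    have hx := (Finset.mem_filter.1 hx).2
    rw [List.mem_cons, mem_CW] at hy
    rcases hy with rfl | hy
    · exact hm'.trans_lt hx
    · exact ((Finset.mem_filter.1 hy).2.trans_le h).trans hx

theorem CW_split (γ : Finset A) (z : A) (hz : z ∈ γ) :
    CW γ = CW (γ.filter (z < ·)) ++ z :: CW (γ.filter (· < z)) := by
  apply CW_uniq _ _ (split_pw γ z z le_rfl z le_rfl le_rfl)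
  intro x
  simp only [List.mem_append, List.mem_cons, mem_CW, Finset.mem_filter]
  constructor
  · rintro (h | rfl | h)
    exacts [h.1, hz, h.1]
  · intro h
    rcases lt_trichotomy x z with h1 | h1 | h1 <;> simp [h, h1]

theorem LB (γ : Finset A) (z : A) (hz : z ∈ γ) : styGen z * GW (CW γ) = GW (CW γ) := by
  rw [CW_split γ z hz, GW_append, GW_cons]
  have := FB z (CW (γ.filter (z < ·))) (CW_pw _) (by intro x hx; rw [mem_CW] at hx; simp_all)
  simp only [← mul_assoc] at this ⊢
  rw [this]

theorem LBB (γ : Finset A) (l : List A) (h : ∀ x ∈ l, x ∈ γ) :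
    GW l * GW (CW γ) = GW (CW γ) := by
  induction l with
  | nil => simp [GW_nil]
  | cons a l ih =>
    rw [GW_cons, mul_assoc, ih (fun x hx => h x (by simp [hx])), LB _ _ (h a (by simp))]

theorem LA (a : A) (γ : Finset A) :
    ∃ v, styGen a * GW (CW γ) = GW (CW (lIns a γ)) * v := by
  unfold lIns
  split_ifs with h
  · set z := (γ.filter (a ≤ ·)).min' h with hz
    have hzm := Finset.min'_mem _ h
    rw [← hz, Finset.mem_filter] at hzm
    have hmin : ∀ x ∈ γ, a ≤ x → z ≤ x := fun x hx hax =>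
      Finset.min'_le _ _ (Finset.mem_filter.2 ⟨hx, hax⟩)
    clear_value z
    rcases hzm.2.eq_or_lt with rfl | haz
    · rw [Finset.insert_erase hzm.1]
      exact ⟨1, by rw [mul_one, LB _ _ hzm.1]⟩
    · refine ⟨styGen z, ?_⟩
      have e : CW (insert a (γ.erase z)) =
          CW (γ.filter (z < ·)) ++ a :: CW (γ.filter (· < a)) := by
        apply CW_uniq _ _ (split_pw γ a z haz.le a le_rfl haz.le)
        intro x
        simp only [List.mem_append, List.mem_cons, mem_CW, Finset.mem_filter, Finset.mem_insert,
          Finset.mem_erase]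
        grind
      have e' : γ.filter (· < z) = γ.filter (· < a) := by
        ext x
        simp only [Finset.mem_filter]
        grind
      have p := split_pw γ a z haz.le a le_rfl haz.le
      have f1 := F1 z (CW (γ.filter (· < a))) a haz (List.pairwise_append.1 p).2.1
      have f2 := F2 haz (CW (γ.filter (z < ·))) (CW_pw _)
        (by intro x hx; rw [mem_CW] at hx; simp_all)
      rw [e, CW_split γ z hzm.1, e', GW_append, GW_append, GW_cons, GW_cons, mul_assoc, mul_assoc,
        f1]
      simp only [← mul_assoc] at f2 ⊢
      rw [f2]
  · refine ⟨1, ?_⟩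
    rw [mul_one, CW_uniq (insert a γ) (a :: CW γ), GW_cons]
    · rw [List.pairwise_cons]
      refine ⟨?_, CW_pw _⟩
      intro x hx
      rw [mem_CW] at hx
      by_contra hh
      exact h ⟨x, Finset.mem_filter.2 ⟨hx, not_lt.1 hh⟩⟩
    · intro x
      simp [mem_CW]

theorem LC (l : List A) (γ : Finset A) :
    ∃ v, GW l * GW (CW γ) = GW (CW (lActW l γ)) * v := by
  induction l with
  | nil => exact ⟨1, by simp [GW_nil, lActW]⟩
  | cons a l ih =>
    obtain ⟨v, hv⟩ := ih
    obtain ⟨v', hv'⟩ := LA a (lActW l γ)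
    refine ⟨v' * v, ?_⟩
    rw [GW_cons, mul_assoc, hv, ← mul_assoc, hv', mul_assoc]
    rfl

theorem LD [Fintype A] (γ δ : Finset A) (l : List A) (h : ¬ lActW l δ ⊆ γ) :
    PW ((γᶜ).sort (· ≤ ·)) * (GW l * GW (CW δ)) = 0 := by
  obtain ⟨v, hv⟩ := LC l δ
  obtain ⟨x, hx, hxγ⟩ := Finset.not_subset.1 h
  rw [hv, ← LB _ x hx, mul_assoc, ← mul_assoc (PW _),
    L1 x _ (Finset.sortedLT_sort _).pairwise (by simpa using hxγ), zero_mul]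

theorem card_lIns (a : A) (T : Finset A) (t : A) :
    (T.filter (· ≤ t)).card ≤ ((lIns a T).filter (· ≤ t)).card := by
  unfold lIns
  split_ifs with h
  · set z := (T.filter (a ≤ ·)).min' h with hz
    have hzm := Finset.min'_mem _ h
    rw [← hz, Finset.mem_filter] at hzm
    clear_value z
    rcases hzm.2.eq_or_lt with rfl | haz
    · rw [Finset.insert_erase hzm.1]
    · by_cases hzt : z ≤ t
      · rw [Finset.filter_insert, if_pos (haz.le.trans hzt), Finset.filter_erase]
        by_cases haT : a ∈ T
        · subst hz
          have := Finset.min'_le (T.filter (a ≤ ·)) a (by simp [haT])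
          exact absurd haz (not_lt.2 this)
        · rw [Finset.card_insert_of_notMem (by simp [haT])]
          have := Finset.pred_card_le_card_erase (s := T.filter (· ≤ t)) (a := z)
          omega
      · apply Finset.card_le_card
        intro x
        simp only [Finset.mem_filter, Finset.mem_insert, Finset.mem_erase]
        grind
  · apply Finset.card_le_card
    intro x
    simp only [Finset.mem_filter, Finset.mem_insert]
    grind

theorem card_lIns_lt (a : A) (T : Finset A) (ha : a ∉ T) :
    (T.filter (· ≤ a)).card < ((lIns a T).filter (· ≤ a)).card := by
  apply Finset.card_lt_card
  rw [Finset.ssubset_iff_of_subset]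
  · refine ⟨a, ?_, by simp [ha]⟩
    unfold lIns
    split_ifs <;> simp
  · intro x
    unfold lIns
    split_ifs with h
    · have hzm := Finset.min'_mem _ h
      rw [Finset.mem_filter] at hzm
      simp only [Finset.mem_filter, Finset.mem_insert, Finset.mem_erase]
      grind
    · simp only [Finset.mem_filter, Finset.mem_insert]
      grind

theorem card_lActW (l : List A) (T : Finset A) (t : A) :
    (T.filter (· ≤ t)).card ≤ ((lActW l T).filter (· ≤ t)).card := by
  induction l with
  | nil => exact le_rfl
  | cons a l ih => exact ih.trans (card_lIns a (lActW l T) t)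

theorem mem_lIns_self (a : A) (T : Finset A) : a ∈ lIns a T := by
  unfold lIns
  split_ifs <;> simp

theorem mem_lIns_lt (a : A) (T : Finset A) (x : A) (hx : x < a) (hT : x ∈ T) : x ∈ lIns a T := by
  unfold lIns
  split_ifs with h
  · have hzm := Finset.min'_mem _ h
    rw [Finset.mem_filter] at hzm
    simp only [Finset.mem_insert, Finset.mem_erase]
    grind
  · simp [hT]

theorem sub_lActW (l : List A) (hl : l.Pairwise (· > ·)) (T : Finset A) (x : A) (hx : x ∈ l) :
    x ∈ lActW l T := by
  induction l with
  | nil => simp at hx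
  | cons a l ih =>
    change x ∈ lIns a (lActW l T)
    rcases List.mem_cons.1 hx with rfl | h
    · exact mem_lIns_self _ _
    · exact mem_lIns_lt _ _ _ (List.rel_of_pairwise_cons hl h) (ih hl.of_cons h)

theorem lActW_append (l m : List A) (T : Finset A) : lActW (l ++ m) T = lActW l (lActW m T) := by
  simp [lActW]

theorem LE5 (γ δ : Finset A) (b c : A) (hbc : b < c) (hcγ : c ∉ γ)
    (hδ : δ = insert c (γ.erase b)) (u : List A) (hu : ∀ x ∈ u, x ∉ δ) (hne : u ≠ []) :
    ¬ lActW (b :: (CW δ ++ u)) δ ⊆ γ := by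
  obtain ⟨u', s, rfl⟩ : ∃ u' s, u = u' ++ [s] := ⟨_, _, (List.dropLast_append_getLast hne).symm⟩
  have hs := hu s (by simp)
  have key : lActW (b :: (CW δ ++ (u' ++ [s]))) δ
      = lIns b (lActW (CW δ) (lActW u' (lIns s δ))) := by
    simp [lActW]
  rw [key]
  have h1 := ((card_lIns_lt s δ hs).trans_le (card_lActW u' _ s)).trans_le
    (card_lActW (CW δ) _ s)
  have h2 : ∀ x ∈ δ, x ∈ lActW (CW δ) (lActW u' (lIns s δ)) := fun x hx =>
    sub_lActW _ (CW_pw δ) _ _ ((mem_CW δ x).2 hx)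
  generalize lActW (CW δ) (lActW u' (lIns s δ)) = U at h1 h2
  intro hsub
  obtain ⟨x, hxU, hxδ⟩ : ∃ x ∈ U, x ∉ δ := by
    by_contra! hh
    exact absurd (Finset.card_le_card (Finset.filter_subset_filter (· ≤ s) hh)) (not_le.2 h1)
  have hcδ : c ∈ δ := by simp [hδ]
  have hcU := h2 c hcδ
  have hn : (U.filter (b ≤ ·)).Nonempty := ⟨c, Finset.mem_filter.2 ⟨hcU, hbc.le⟩⟩
  unfold lIns at hsub
  rw [dif_pos hn] at hsub
  have hzl : ∀ y ∈ U, b ≤ y → (U.filter (b ≤ ·)).min' hn ≤ y := fun y hy hby =>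
    Finset.min'_le _ _ (Finset.mem_filter.2 ⟨hy, hby⟩)
  generalize (U.filter (b ≤ ·)).min' hn = z at hsub hzl
  have hzc : z = c := by
    by_contra hne
    exact hcγ (hsub (by simp [hcU, Ne.symm hne]))
  subst hzc
  have hxz : x ≠ z := fun h => hxδ (h ▸ hcδ)
  have hxγ := hsub (by simp [hxU, hxz] : x ∈ _)
  have hxb : x = b := by
    by_contra hxb
    exact hxδ (by simp [hδ, hxγ, hxb])
  subst hxb
  exact absurd (hzl x hxU le_rfl) (not_le.2 hbc)

theorem LF (γ δ : Finset A) (b c : A) (hbc : b < c) (hcγ : c ∉ γ) (hbγ : b ∈ γ)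
    (hmax : ∀ x ∈ γ, x ≤ c → x ≤ b) (hδ : δ = insert c (γ.erase b)) :
    GW (CW γ) * styGen c = styGen b * GW (CW δ) := by
  have e : CW δ = CW (γ.filter (c < ·)) ++ c :: CW (γ.filter (· < b)) := by
    apply CW_uniq _ _ (split_pw γ b c hbc.le c hbc.le le_rfl)
    intro x
    simp only [hδ, List.mem_append, List.mem_cons, mem_CW, Finset.mem_filter, Finset.mem_insert,
      Finset.mem_erase]
    grind
  have e' : γ.filter (b < ·) = γ.filter (c < ·) := by
    ext x
    simp only [Finset.mem_filter]
    grind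
  have p := split_pw γ b c hbc.le b le_rfl hbc.le
  have f1 := F1 c (CW (γ.filter (· < b))) b hbc (List.pairwise_append.1 p).2.1
  have f2 := F2 hbc (CW (γ.filter (c < ·))) (CW_pw _)
    (by intro x hx; rw [mem_CW] at hx; simp_all)
  rw [e, CW_split γ b hbγ, e', GW_append, GW_append, GW_cons, GW_cons, mul_assoc, mul_assoc,
    f1]
  simp only [← mul_assoc] at f2 ⊢
  rw [f2]

theorem LG [Fintype A] (γ δ : Finset A) (b c : A) (hbc : b < c) (hcγ : c ∉ γ)
    (hδ : δ = insert c (γ.erase b)) (l : List A) (hl : ∀ x ∈ l, x ∉ δ) :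
    ∀ u : List A, (∀ x ∈ u, x ∉ δ) →
    PW ((γᶜ).sort (· ≤ ·)) * (GW (b :: (CW δ ++ u)) * (PW l * GW (CW δ))) =
      if u = [] then PW ((γᶜ).sort (· ≤ ·)) * (styGen b * GW (CW δ)) else 0 := by
  induction l with
  | nil =>
    intro u hu
    rw [PW_nil, one_mul]
    split_ifs with h
    · subst h
      rw [List.append_nil, GW_cons, mul_assoc, LBB δ (CW δ) (fun x hx => (mem_CW δ x).1 hx)]
    · exact LD _ _ _ (LE5 γ δ b c hbc hcγ hδ u hu h)
  | cons a l ih =>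
    intro u hu
    have ih := ih (fun x hx => hl x (by simp [hx]))
    have i1 := ih u hu
    have i2 := ih (u ++ [a]) (by
      intro x hx
      rcases List.mem_append.1 hx with h | h
      · exact hu x h
      · rw [List.mem_singleton.1 h]; exact hl a (by simp))
    rw [if_neg (by simp)] at i2
    have e : GW (b :: (CW δ ++ (u ++ [a]))) = GW (b :: (CW δ ++ u)) * styGen a := by
      simp [GW, mul_assoc]
    rw [e, mul_assoc (GW _)] at i2
    rw [PW_cons, mul_assoc (1 - styGen a), sub_mul, one_mul, mul_sub, mul_sub, i1, i2, sub_zero]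

end helpers

/-- Lemma `identity`, second identity: if `γ → δ` is a
frank right action by `c` with bumped letter `b`, then `e_γ c e_δ = e_γ c`
in `ℤStyl(A)`. -/
theorem eIdem_edge_right {A : Type*} [LinearOrder A] [Fintype A]
    (γ : Finset A) (c : A) (hcγ : c ∉ γ)
    (hfil : (γ.filter (· ≤ c)).Nonempty)
    (b : A) (hb : b = (γ.filter (· ≤ c)).max' hfil)
    (δ : Finset A) (hδ : δ = insert c (γ.erase b)) :
    eIdem γ * styGen c * eIdem δ = eIdem γ * styGen c := by
  have hm := Finset.max'_mem _ hfil
  rw [← hb, Finset.mem_filter] at hm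
  have hmax : ∀ x ∈ γ, x ≤ c → x ≤ b := fun x hx hxc => by
    rw [hb]
    exact Finset.le_max' _ _ (Finset.mem_filter.2 ⟨hx, hxc⟩)
  have hbc : b < c := lt_of_le_of_ne hm.2 (fun h => hcγ (h ▸ hm.1))
  have f := LF γ δ b c hbc hcγ hm.1 hmax hδ
  have g := LG γ δ b c hbc hcγ hδ ((δᶜ).sort (· ≤ ·)) (by simp) [] (by simp)
  rw [if_pos rfl, List.append_nil, GW_cons] at g
  change PW ((γᶜ).sort (· ≤ ·)) * GW (CW γ) * styGen c *
    (PW ((δᶜ).sort (· ≤ ·)) * GW (CW δ)) = PW ((γᶜ).sort (· ≤ ·)) * GW (CW γ) * styGen c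
  rw [mul_assoc (PW ((γᶜ).sort (· ≤ ·))), f, mul_assoc, g]
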